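/- arXiv:1507.01637 — 2 statements merged into one kernel-verified Lean document; each statement's English description precedes it below -/
import Mathlib

section
/- Let J be a finite index set with |J| = n ≥ 1, let d ≥ 1, let r = (r_j)_{j∈J} be nonnegative radii, and let τ be a binary hierarchy over J. Then the stratum S(τ) ⊆ Conf(ℝᵈ, J, r) of disk configurations supporting τ is homotopy equivalent to the product (S^{d−1})^{n−1} of n−1 copies of the (d−1)-dimensional unit sphere. -/
open Finset

/-- A binary hierarchy over a finite index set `J`, encoded by its cluster set:
a laminar family of nonempty subsets of `J` containing the root `J` and all
singletons, in which every nonsingleton member is the disjoint union of exactly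
two members (its children). -/
structure BinaryHierarchy (J : Type*) [DecidableEq J] [Fintype J] where
  clusters : Finset (Finset J)
  root_mem : (Finset.univ : Finset J) ∈ clusters
  singleton_mem : ∀ j : J, ({j} : Finset J) ∈ clusters
  nonempty_of_mem : ∀ I ∈ clusters, I.Nonempty
  laminar : ∀ I ∈ clusters, ∀ K ∈ clusters, I ⊆ K ∨ K ⊆ I ∨ Disjoint I K
  binary_split : ∀ I ∈ clusters, 1 < I.card →
    ∃ L ∈ clusters, ∃ R ∈ clusters, Disjoint L R ∧ L ∪ R = I

variable {J : Type*} [DecidableEq J] [Fintype J]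

/-- The parent of a cluster `I`: the smallest member of the (laminar) family strictly
containing `I`, realized as the intersection of all members strictly containing `I`
(these form a chain in a laminar family). -/
def BinaryHierarchy.parent (τ : BinaryHierarchy J) (I : Finset J) : Finset J :=
  (τ.clusters.filter fun K => I ⊂ K).inf id

/-- The sibling (local complement) of a cluster `I`. -/
def BinaryHierarchy.sibling (τ : BinaryHierarchy J) (I : Finset J) : Finset J :=
  τ.parent I \ I

open scoped RealInnerProductSpace

/-- Centroid of the partial configuration `x|A`. -/
noncomputable def centroid {E : Type*} [NormedAddCommGroup E] [NormedSpace ℝ E]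
    (x : J → E) (A : Finset J) : E :=
  (A.card : ℝ)⁻¹ • ∑ a ∈ A, x a

/-- The configuration space of labelled, noncolliding disks with radii `r` in `ℝ^d`. -/
def Conf (d : ℕ) (J : Type*) (r : J → ℝ) : Set (J → EuclideanSpace ℝ (Fin d)) :=
  {x | ∀ i j : J, i ≠ j → r i + r j < ‖x i - x j‖}

/-- `s_I(x)`: difference of the centroids of the cluster `I` and its sibling. -/
noncomputable def sepVec (τ : BinaryHierarchy J) {d : ℕ}
    (x : J → EuclideanSpace ℝ (Fin d)) (I : Finset J) : EuclideanSpace ℝ (Fin d) :=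
  centroid x I - centroid x (τ.sibling I)

/-- `m_I(x)`: midpoint of the centroids of the cluster `I` and its sibling. -/
noncomputable def midpt (τ : BinaryHierarchy J) {d : ℕ}
    (x : J → EuclideanSpace ℝ (Fin d)) (I : Finset J) : EuclideanSpace ℝ (Fin d) :=
  (2 : ℝ)⁻¹ • (centroid x I + centroid x (τ.sibling I))

/-- `σ_{i,I,τ}(x)`: signed distance of agent `i` to the separating hyperplane of `I`
and its sibling. -/
noncomputable def separation (τ : BinaryHierarchy J) {d : ℕ}
    (x : J → EuclideanSpace ℝ (Fin d)) (I : Finset J) (i : J) : ℝ :=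
  ⟪x i - midpt τ x I, ‖sepVec τ x I‖⁻¹ • sepVec τ x I⟫

/-- The stratum of configurations supporting the binary hierarchy `τ`. -/
def stratum (d : ℕ) (r : J → ℝ) (τ : BinaryHierarchy J) :
    Set (J → EuclideanSpace ℝ (Fin d)) :=
  {x | x ∈ Conf d J r ∧ ∀ I ∈ τ.clusters, I ≠ Finset.univ →
      sepVec τ x I ≠ 0 ∧ ∀ i ∈ I, 0 ≤ separation τ x I i}

namespace BinaryHierarchy

variable (τ : BinaryHierarchy J)

/-- The nonsingleton clusters of a hierarchy. -/
def internal : Finset (Finset J) := τ.clusters.filter fun I => 1 < I.card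

variable {τ}

lemma internal_mem (I : τ.internal) : I.1 ∈ τ.clusters :=
  (Finset.mem_filter.1 I.2).1

lemma internal_card (I : τ.internal) : 1 < I.1.card :=
  (Finset.mem_filter.1 I.2).2

/-- A chosen child of a nonsingleton cluster. -/
noncomputable def left (I : τ.internal) : Finset J :=
  (τ.binary_split I.1 (internal_mem I) (internal_card I)).choose

lemma left_mem (I : τ.internal) : left I ∈ τ.clusters :=
  (τ.binary_split I.1 (internal_mem I) (internal_card I)).choose_spec.1

/-- The other child of a nonsingleton cluster. -/
noncomputable def right (I : τ.internal) : Finset J :=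
  (τ.binary_split I.1 (internal_mem I) (internal_card I)).choose_spec.2.choose

lemma right_mem (I : τ.internal) : right I ∈ τ.clusters :=
  (τ.binary_split I.1 (internal_mem I) (internal_card I)).choose_spec.2.choose_spec.1

lemma disjoint_left_right (I : τ.internal) : Disjoint (left I) (right I) :=
  (τ.binary_split I.1 (internal_mem I) (internal_card I)).choose_spec.2.choose_spec.2.1

lemma left_union_right (I : τ.internal) : left I ∪ right I = I.1 :=
  (τ.binary_split I.1 (internal_mem I) (internal_card I)).choose_spec.2.choose_spec.2.2

lemma left_subset (I : τ.internal) : left I ⊆ I.1 :=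
  left_union_right I ▸ Finset.subset_union_left

lemma right_subset (I : τ.internal) : right I ⊆ I.1 :=
  left_union_right I ▸ Finset.subset_union_right

lemma left_nonempty (I : τ.internal) : (left I).Nonempty :=
  τ.nonempty_of_mem _ (left_mem I)

lemma right_nonempty (I : τ.internal) : (right I).Nonempty :=
  τ.nonempty_of_mem _ (right_mem I)

lemma card_left_add_card_right (I : τ.internal) :
    (left I).card + (right I).card = I.1.card := by
  rw [← Finset.card_union_of_disjoint (disjoint_left_right I), left_union_right]

lemma left_ssubset (I : τ.internal) : left I ⊂ I.1 := by
  refine LE.le.ssubset_of_ne (left_subset I) fun h => ?_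
  have h1 := card_left_add_card_right I
  have h2 := (right_nonempty I).card_pos
  rw [h] at h1
  omega

lemma right_ssubset (I : τ.internal) : right I ⊂ I.1 := by
  refine LE.le.ssubset_of_ne (right_subset I) fun h => ?_
  have h1 := card_left_add_card_right I
  have h2 := (left_nonempty I).card_pos
  rw [h] at h1
  omega

lemma subset_left_or_subset_right (I : τ.internal) {K : Finset J} (hK : K ∈ τ.clusters)
    (h : K ⊂ I.1) : K ⊆ left I ∨ K ⊆ right I := by
  obtain ⟨k, hk⟩ := τ.nonempty_of_mem K hK
  rcases τ.laminar K hK _ (left_mem I) with h1 | h1 | h1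
  · exact Or.inl h1
  · rcases τ.laminar K hK _ (right_mem I) with h2 | h2 | h2
    · exact Or.inr h2
    · exact absurd (left_union_right I ▸ Finset.union_subset h1 h2) h.2
    · left
      intro a ha
      have := h.1 ha
      rw [← left_union_right, Finset.mem_union] at this
      exact this.resolve_right (Finset.disjoint_left.1 h2 ha)
  · right
    intro a ha
    have := h.1 ha
    rw [← left_union_right, Finset.mem_union] at this
    exact this.resolve_left (Finset.disjoint_left.1 h1 ha)

lemma parent_eq (I : τ.internal) {K : Finset J} (hK : K ∈ τ.clusters) (hKI : K ⊂ I.1)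
    (hmin : ∀ K' ∈ τ.clusters, K ⊂ K' → ¬ K' ⊂ I.1) : τ.parent K = I.1 := by
  apply le_antisymm
  · exact Finset.inf_le (f := id) (Finset.mem_filter.2 ⟨internal_mem I, hKI⟩)
  · refine Finset.le_inf fun K' hK' => ?_
    rw [Finset.mem_filter] at hK'
    rcases τ.laminar _ (internal_mem I) K' hK'.1 with h | h | h
    · exact h
    · by_contra h'
      exact hmin K' hK'.1 hK'.2 ⟨h, h'⟩
    · obtain ⟨k, hk⟩ := τ.nonempty_of_mem K hK
      exact absurd (hK'.2.1 hk) (Finset.disjoint_left.1 h (hKI.1 hk))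

lemma sibling_left (I : τ.internal) : τ.sibling (left I) = right I := by
  rw [sibling, parent_eq I (left_mem I) (left_ssubset I), ← left_union_right,
    Finset.union_sdiff_cancel_left (disjoint_left_right I)]
  intro K' hK' h1 h2
  rcases subset_left_or_subset_right I hK' h2 with h | h
  · exact h1.2 h
  · obtain ⟨k, hk⟩ := left_nonempty I
    exact Finset.disjoint_left.1 (disjoint_left_right I) hk (h (h1.1 hk))

lemma sibling_right (I : τ.internal) : τ.sibling (right I) = left I := by
  rw [sibling, parent_eq I (right_mem I) (right_ssubset I), ← left_union_right,
    Finset.union_sdiff_cancel_right (disjoint_left_right I)]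
  intro K' hK' h1 h2
  rcases subset_left_or_subset_right I hK' h2 with h | h
  · obtain ⟨k, hk⟩ := right_nonempty I
    exact Finset.disjoint_left.1 (disjoint_left_right I) (h (h1.1 hk)) hk
  · exact h1.2 h

lemma exists_eq_left_or_eq_right {K : Finset J} (hK : K ∈ τ.clusters) (hne : K ≠ Finset.univ) :
    ∃ I : τ.internal, K = left I ∨ K = right I := by
  obtain ⟨P, hP, hmin⟩ := (τ.clusters.filter fun K' => K ⊂ K').exists_min_image Finset.card
    ⟨Finset.univ, Finset.mem_filter.2 ⟨τ.root_mem, Finset.ssubset_univ_iff.2 hne⟩⟩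
  rw [Finset.mem_filter] at hP
  have hcard : 1 < P.card :=
    lt_of_le_of_lt (τ.nonempty_of_mem K hK).card_pos (Finset.card_lt_card hP.2)
  let I : τ.internal := ⟨P, Finset.mem_filter.2 ⟨hP.1, hcard⟩⟩
  refine ⟨I, ?_⟩
  rcases subset_left_or_subset_right I hK hP.2 with h | h
  · left
    by_contra hne'
    exact absurd (hmin _ (Finset.mem_filter.2
      ⟨left_mem I, LE.le.ssubset_of_ne h hne'⟩))
      (not_le.2 (Finset.card_lt_card (left_ssubset I)))
  · right
    by_contra hne'
    exact absurd (hmin _ (Finset.mem_filter.2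
      ⟨right_mem I, LE.le.ssubset_of_ne h hne'⟩))
      (not_le.2 (Finset.card_lt_card (right_ssubset I)))

lemma exists_separating {i j : J} (hij : i ≠ j) :
    ∃ I : τ.internal, (i ∈ left I ∧ j ∈ right I) ∨ (j ∈ left I ∧ i ∈ right I) := by
  obtain ⟨P, hP, hmin⟩ := (τ.clusters.filter fun K => i ∈ K ∧ j ∈ K).exists_min_image Finset.card
    ⟨Finset.univ, by simp [τ.root_mem]⟩
  rw [Finset.mem_filter] at hP
  have hcard : 1 < P.card := Finset.one_lt_card.2 ⟨i, hP.2.1, j, hP.2.2, hij⟩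
  let I : τ.internal := ⟨P, Finset.mem_filter.2 ⟨hP.1, hcard⟩⟩
  refine ⟨I, ?_⟩
  have hi : i ∈ left I ∪ right I := by rw [left_union_right]; exact hP.2.1
  have hj : j ∈ left I ∪ right I := by rw [left_union_right]; exact hP.2.2
  rw [Finset.mem_union] at hi hj
  rcases hi with hi | hi <;> rcases hj with hj | hj
  · exact absurd (hmin _ (Finset.mem_filter.2 ⟨left_mem I, hi, hj⟩))
      (not_le.2 (Finset.card_lt_card (left_ssubset I)))
  · exact Or.inl ⟨hi, hj⟩
  · exact Or.inr ⟨hj, hi⟩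
  · exact absurd (hmin _ (Finset.mem_filter.2 ⟨right_mem I, hi, hj⟩))
      (not_le.2 (Finset.card_lt_card (right_ssubset I)))

lemma card_internal_filter_subset {K : Finset J} (hK : K ∈ τ.clusters) :
    (τ.internal.filter fun I => I ⊆ K).card + 1 = K.card := by
  induction h : K.card using Nat.strong_induction_on generalizing K with
  | _ m ih =>
    subst h
    have hpos := (τ.nonempty_of_mem K hK).card_pos
    rcases (Nat.succ_le_of_lt hpos).eq_or_lt with h1 | h1
    · rw [← h1, Finset.filter_eq_empty_iff.2]
      · simp
      · intro I hI hIK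
        have := Finset.card_le_card hIK
        have := (Finset.mem_filter.1 hI).2
        omega
    · have hKi : K ∈ τ.internal := Finset.mem_filter.2 ⟨hK, h1⟩
      let P : τ.internal := ⟨K, hKi⟩
      have hL := ih _ (Finset.card_lt_card (left_ssubset P)) (left_mem P) rfl
      have hR := ih _ (Finset.card_lt_card (right_ssubset P)) (right_mem P) rfl
      have hsplit : (τ.internal.filter fun I => I ⊆ K) =
          insert K ((τ.internal.filter fun I => I ⊆ left P) ∪
            (τ.internal.filter fun I => I ⊆ right P)) := by
        ext I
        simp only [Finset.mem_filter, Finset.mem_insert, Finset.mem_union]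
        constructor
        · rintro ⟨hI, hIK⟩
          rcases eq_or_ne I K with h | h
          · exact Or.inl h
          · right
            rw [← and_or_left]
            exact ⟨hI, subset_left_or_subset_right P (Finset.mem_filter.1 hI).1
              (LE.le.ssubset_of_ne hIK h)⟩
        · rintro (rfl | h | h)
          · exact ⟨hKi, subset_rfl⟩
          · exact ⟨h.1, h.2.trans (left_subset P)⟩
          · exact ⟨h.1, h.2.trans (right_subset P)⟩
      have hdisj : Disjoint (τ.internal.filter fun I => I ⊆ left P)
          (τ.internal.filter fun I => I ⊆ right P) := by
        rw [Finset.disjoint_left]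
        intro I h2 h3
        rw [Finset.mem_filter] at h2 h3
        obtain ⟨k, hk⟩ := τ.nonempty_of_mem I (Finset.mem_filter.1 h2.1).1
        exact Finset.disjoint_left.1 (disjoint_left_right P) (h2.2 hk) (h3.2 hk)
      rw [hsplit, Finset.card_insert_of_notMem, Finset.card_union_of_disjoint hdisj]
      · have := card_left_add_card_right P
        change _ = K.card at this
        omega
      · simp only [Finset.mem_union, Finset.mem_filter, not_or, not_and]
        exact ⟨fun _ => (left_ssubset P).2, fun _ => (right_ssubset P).2⟩

lemma card_internal : Fintype.card τ.internal = Fintype.card J - 1 := by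
  have := card_internal_filter_subset τ.root_mem
  rw [Finset.filter_true_of_mem fun I _ => Finset.subset_univ I, Finset.card_univ] at this
  rw [Fintype.card_coe]
  omega

/-- The coordinate of agent `j` along the separation vector of the children of `I`. -/
noncomputable def coeff (I : τ.internal) (j : J) : ℝ :=
  if j ∈ left I then (right I).card / I.1.card
  else if j ∈ right I then -((left I).card / I.1.card) else 0

lemma coeff_of_mem_left {I : τ.internal} {j : J} (hj : j ∈ left I) :
    coeff I j = (right I).card / I.1.card := if_pos hj

lemma coeff_of_mem_right {I : τ.internal} {j : J} (hj : j ∈ right I) :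
    coeff I j = -((left I).card / I.1.card) := by
  rw [coeff, if_neg (Finset.disjoint_right.1 (disjoint_left_right I) hj), if_pos hj]

lemma coeff_of_notMem {I : τ.internal} {j : J} (hj : j ∉ I.1) : coeff I j = 0 := by
  rw [coeff, if_neg fun h => hj (left_subset I h), if_neg fun h => hj (right_subset I h)]

lemma abs_coeff_le_one (I : τ.internal) (j : J) : |coeff I j| ≤ 1 := by
  have h0 : (0 : ℝ) < I.1.card := by exact_mod_cast (zero_lt_one.trans (internal_card I))
  have hL : ((left I).card : ℝ) ≤ I.1.card := by
    exact_mod_cast Finset.card_le_card (left_subset I)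
  have hR : ((right I).card : ℝ) ≤ I.1.card := by
    exact_mod_cast Finset.card_le_card (right_subset I)
  unfold coeff
  split_ifs
  · rw [abs_of_nonneg (by positivity)]
    exact (div_le_one h0).2 hR
  · rw [abs_neg, abs_of_nonneg (by positivity)]
    exact (div_le_one h0).2 hL
  · simp

lemma sum_coeff (I : τ.internal) : ∑ j ∈ I.1, coeff I j = 0 := by
  rw [← left_union_right I, Finset.sum_union (disjoint_left_right I),
    Finset.sum_congr rfl fun j hj => coeff_of_mem_left hj,
    Finset.sum_congr rfl fun j hj => coeff_of_mem_right hj]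
  simp only [Finset.sum_const, nsmul_eq_mul]
  ring

end BinaryHierarchy

lemma centroid_eq_of_const {ι E : Type*} [NormedAddCommGroup E] [NormedSpace ℝ E]
    {x : ι → E} {A : Finset ι} {v : E} (hA : A.Nonempty) (h : ∀ a ∈ A, x a = v) :
    _root_.centroid x A = v := by
  have : (A.card : ℝ) ≠ 0 := by exact_mod_cast hA.card_pos.ne'
  rw [_root_.centroid, Finset.sum_congr rfl h, Finset.sum_const, ← Nat.cast_smul_eq_nsmul ℝ, smul_smul,
    inv_mul_cancel₀ this, one_smul]

lemma centroid_combination {ι E : Type*} [NormedAddCommGroup E] [NormedSpace ℝ E]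
    (a b : ℝ) (x y : ι → E) (A : Finset ι) :
    _root_.centroid (a • x + b • y) A = a • _root_.centroid x A + b • _root_.centroid y A := by
  simp only [_root_.centroid, Pi.add_apply, Pi.smul_apply, Finset.sum_add_distrib, ← Finset.smul_sum,
    smul_add]
  rw [smul_comm _ a, smul_comm _ b]

namespace BinaryHierarchy

variable {τ : BinaryHierarchy J}

lemma centroid_coeff_of_subset {I : τ.internal} {K : Finset J} (h : I.1 ⊆ K) :
    _root_.centroid (coeff I) K = 0 := by
  rw [_root_.centroid, ← Finset.sum_subset h fun j _ hj => coeff_of_notMem hj, sum_coeff, smul_zero]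

lemma coeff_congr {I : τ.internal} {K : Finset J} (hK : K ∈ τ.clusters) (h : ¬ I.1 ⊆ K)
    {i j : J} (hi : i ∈ K) (hj : j ∈ K) : coeff I i = coeff I j := by
  rcases τ.laminar _ (internal_mem I) K hK with h1 | h1 | h1
  · exact absurd h1 h
  · rcases subset_left_or_subset_right I hK ⟨h1, h⟩ with h2 | h2
    · rw [coeff_of_mem_left (h2 hi), coeff_of_mem_left (h2 hj)]
    · rw [coeff_of_mem_right (h2 hi), coeff_of_mem_right (h2 hj)]
  · rw [coeff_of_notMem (Finset.disjoint_right.1 h1 hi),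
      coeff_of_notMem (Finset.disjoint_right.1 h1 hj)]

lemma centroid_coeff_of_not_subset {I : τ.internal} {K : Finset J} (hK : K ∈ τ.clusters)
    (h : ¬ I.1 ⊆ K) {i : J} (hi : i ∈ K) : _root_.centroid (coeff I) K = coeff I i :=
  centroid_eq_of_const ⟨i, hi⟩ fun _ ha => coeff_congr hK h ha hi

lemma coeff_left_sub_coeff_right (P : τ.internal) {i j : J} (hi : i ∈ left P)
    (hj : j ∈ right P) : coeff P i - coeff P j = 1 := by
  have h0 : (P.1.card : ℝ) ≠ 0 := by
    exact_mod_cast (zero_lt_one.trans (internal_card P)).ne'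
  have h1 : ((left P).card : ℝ) + (right P).card = P.1.card := by
    exact_mod_cast card_left_add_card_right P
  rw [coeff_of_mem_left hi, coeff_of_mem_right hj]
  field_simp
  linarith

lemma centroid_coeff_left_sub_right (I P : τ.internal) :
    _root_.centroid (coeff I) (left P) - _root_.centroid (coeff I) (right P) = if I = P then 1 else 0 := by
  obtain ⟨i, hi⟩ := left_nonempty P
  obtain ⟨j, hj⟩ := right_nonempty P
  split_ifs with h
  · subst h
    rw [centroid_coeff_of_not_subset (left_mem I) (left_ssubset I).2 hi,
      centroid_coeff_of_not_subset (right_mem I) (right_ssubset I).2 hj,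
      coeff_left_sub_coeff_right I hi hj]
  · by_cases hIP : I.1 ⊆ P.1
    · have hss := LE.le.ssubset_of_ne hIP fun h' => h (Subtype.ext h')
      rcases subset_left_or_subset_right P (internal_mem I) hss with h1 | h1
      · rw [centroid_coeff_of_subset h1, centroid_eq_of_const (v := 0) (right_nonempty P), sub_zero]
        exact fun a ha => coeff_of_notMem fun ha' =>
          Finset.disjoint_left.1 (disjoint_left_right P) (h1 ha') ha
      · rw [centroid_coeff_of_subset h1, centroid_eq_of_const (v := 0) (left_nonempty P), sub_zero]
        exact fun a ha => coeff_of_notMem fun ha' =>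
          Finset.disjoint_left.1 (disjoint_left_right P) ha (h1 ha')
    · rw [centroid_coeff_of_not_subset (left_mem P) (fun h' => hIP (h'.trans (left_subset P))) hi,
        centroid_coeff_of_not_subset (right_mem P) (fun h' => hIP (h'.trans (right_subset P))) hj,
        coeff_congr (internal_mem P) hIP (left_subset P hi) (right_subset P hj), sub_self]

/-- A weight on clusters growing so fast that each cluster dominates all its proper subclusters. -/
noncomputable def weight (r : J → ℝ) (I : τ.internal) : ℝ :=
  (1 + 8 * ∑ j, r j) * (16 * Fintype.card τ.internal + 1 : ℝ) ^ I.1.card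

section Weight

variable {r : J → ℝ}

lemma lt_weight (hr : ∀ j, 0 ≤ r j) (I : τ.internal) : 8 * ∑ j, r j < weight r I := by
  have h0 : 0 ≤ ∑ j, r j := Finset.sum_nonneg fun j _ => hr j
  have h1 : (1 : ℝ) ≤ (16 * Fintype.card τ.internal + 1 : ℝ) ^ I.1.card :=
    one_le_pow₀ (by have : (0 : ℝ) ≤ Fintype.card τ.internal := by positivity
                    linarith)
  unfold weight
  nlinarith

lemma weight_pos (hr : ∀ j, 0 ≤ r j) (I : τ.internal) : 0 < weight r I :=
  lt_of_le_of_lt (mul_nonneg (by norm_num) (Finset.sum_nonneg fun j _ => hr j)) (lt_weight hr I)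

lemma sum_weight_le (hr : ∀ j, 0 ≤ r j) (P : τ.internal) :
    ∑ I : τ.internal, (if I.1 ⊂ P.1 then 2 else 0) * weight r I ≤ weight r P / 8 := by
  have h0 : 0 ≤ ∑ j, r j := Finset.sum_nonneg fun j _ => hr j
  set C : ℝ := 1 + 8 * ∑ j, r j with hC
  have hC0 : 0 < C := by positivity
  set N : ℝ := (Fintype.card τ.internal : ℝ) with hN
  have hN0 : 0 ≤ N := by positivity
  obtain ⟨k, hk⟩ : ∃ k, P.1.card = k + 1 :=
    ⟨P.1.card - 1, by have := internal_card P; omega⟩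
  have hbound : ∀ I : τ.internal,
      (if I.1 ⊂ P.1 then 2 else 0) * weight r I ≤ 2 * (C * (16 * N + 1) ^ k) := by
    intro I
    split_ifs with h
    · have hlt := Finset.card_lt_card h
      unfold weight
      gcongr
      · linarith
      · omega
    · rw [zero_mul]
      positivity
  calc _ ≤ ∑ _I : τ.internal, 2 * (C * (16 * N + 1) ^ k) := Finset.sum_le_sum fun I _ => hbound I
    _ = 2 * N * (C * (16 * N + 1) ^ k) := by
      rw [Finset.sum_const, Finset.card_univ, nsmul_eq_mul]
      ring
    _ ≤ (16 * N + 1) / 8 * (C * (16 * N + 1) ^ k) := by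
      gcongr
      linarith
    _ = weight r P / 8 := by
      rw [weight, hk, pow_succ]
      ring

variable {E : Type*} [NormedAddCommGroup E] [NormedSpace ℝ E]

lemma norm_sum_weight_smul_le (hr : ∀ j, 0 ≤ r j) (P : τ.internal) {c : τ.internal → ℝ}
    (hc : ∀ I, |c I| ≤ if I.1 ⊂ P.1 then 2 else 0) {u : τ.internal → E} (hu : ∀ I, ‖u I‖ = 1) :
    ‖∑ I, (c I * weight r I) • u I‖ ≤ weight r P / 8 := by
  refine (norm_sum_le _ _).trans (le_trans (Finset.sum_le_sum fun I _ => ?_) (sum_weight_le hr P))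
  rw [norm_smul, hu, mul_one, Real.norm_eq_abs, abs_mul, abs_of_pos (weight_pos hr I)]
  exact mul_le_mul_of_nonneg_right (hc I) (weight_pos hr I).le

/-- The well-separated configuration with prescribed separation directions. -/
noncomputable def model (r : J → ℝ) (u : τ.internal → E) (j : J) : E :=
  ∑ I : τ.internal, (coeff I j * weight r I) • u I

lemma centroid_model (u : τ.internal → E) (A : Finset J) :
    _root_.centroid (model r u) A = ∑ I, (_root_.centroid (coeff I) A * weight r I) • u I := by
  simp only [_root_.centroid, model]
  rw [Finset.sum_comm, Finset.smul_sum]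
  refine Finset.sum_congr rfl fun I _ => ?_
  rw [← Finset.sum_smul, smul_smul, ← Finset.sum_mul, smul_eq_mul, mul_assoc]

lemma centroid_model_left_sub_right (u : τ.internal → E) (P : τ.internal) :
    _root_.centroid (model r u) (left P) - _root_.centroid (model r u) (right P) = weight r P • u P := by
  rw [centroid_model, centroid_model, ← Finset.sum_sub_distrib]
  simp_rw [← sub_smul, ← sub_mul, centroid_coeff_left_sub_right]
  simp

lemma norm_model_sub_centroid_le (hr : ∀ j, 0 ≤ r j) {u : τ.internal → E} (hu : ∀ I, ‖u I‖ = 1)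
    (P : τ.internal) {K : Finset J} (hK : K ∈ τ.clusters) (hKP : K ⊂ P.1) {i : J} (hi : i ∈ K) :
    ‖model r u i - _root_.centroid (model r u) K‖ ≤ weight r P / 8 := by
  rw [centroid_model, model, ← Finset.sum_sub_distrib]
  simp_rw [← sub_smul, ← sub_mul]
  refine norm_sum_weight_smul_le hr P (fun I => ?_) hu
  by_cases h : I.1 ⊆ K
  · rw [centroid_coeff_of_subset h, sub_zero, if_pos (lt_of_le_of_lt h hKP)]
    linarith [abs_coeff_le_one I i]
  · rw [centroid_coeff_of_not_subset hK h hi, sub_self, abs_zero]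
    split_ifs <;> norm_num

lemma norm_model_sub_model_sub_le (hr : ∀ j, 0 ≤ r j) {u : τ.internal → E}
    (hu : ∀ I, ‖u I‖ = 1) (P : τ.internal) {i j : J} (hi : i ∈ left P) (hj : j ∈ right P) :
    ‖model r u i - model r u j - weight r P • u P‖ ≤ weight r P / 8 := by
  have : weight r P • u P = ∑ I, ((if I = P then 1 else 0) * weight r I) • u I := by simp
  rw [this, model, model, ← Finset.sum_sub_distrib, ← Finset.sum_sub_distrib]
  simp_rw [← sub_smul, ← sub_mul]
  refine norm_sum_weight_smul_le hr P (fun I => ?_) hu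
  by_cases hIP : I = P
  · subst hIP
    simp [coeff_left_sub_coeff_right I hi hj]
  · rw [if_neg hIP, sub_zero]
    by_cases h : I.1 ⊆ P.1
    · rw [if_pos (LE.le.ssubset_of_ne h fun h' => hIP (Subtype.ext h'))]
      have := abs_sub (coeff I i) (coeff I j)
      linarith [abs_coeff_le_one I i, abs_coeff_le_one I j]
    · rw [coeff_congr (internal_mem P) h (left_subset P hi) (right_subset P hj), sub_self, abs_zero]
      split_ifs <;> norm_num

end Weight

end BinaryHierarchy

lemma norm_convex_combination_gt {E : Type*} [NormedAddCommGroup E] [InnerProductSpace ℝ E]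
    {a b : E} {ρ s t : ℝ} (hs : 0 ≤ s) (ht : 0 ≤ t) (hst : s + t = 1) (ha : 2 * ρ < ‖a‖)
    (hb : 2 * ρ < ‖b‖) (hab : -(‖a‖ * ‖b‖ / 2) ≤ ⟪a, b⟫) : ρ < ‖s • a + t • b‖ := by
  have h1 : 2 * ρ < s * ‖a‖ + t * ‖b‖ := by
    rcases hs.eq_or_lt with rfl | hs'
    · obtain rfl : t = 1 := by linarith
      linarith
    · nlinarith [mul_lt_mul_of_pos_left ha hs', mul_le_mul_of_nonneg_left hb.le ht,
        congrArg (· * (2 * ρ)) hst]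
  have h2 : ‖s • a + t • b‖ ^ 2 = (s * ‖a‖) ^ 2 + 2 * (s * t * ⟪a, b⟫) + (t * ‖b‖) ^ 2 := by
    rw [norm_add_sq_real, norm_smul, norm_smul, real_inner_smul_left, real_inner_smul_right,
      Real.norm_of_nonneg hs, Real.norm_of_nonneg ht]
    ring
  have h3 : ((s * ‖a‖ + t * ‖b‖) / 2) ^ 2 ≤ ‖s • a + t • b‖ ^ 2 := by
    have := mul_le_mul_of_nonneg_left hab (mul_nonneg hs ht)
    rw [h2]
    nlinarith [sq_nonneg (s * ‖a‖ - t * ‖b‖)]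
  have h4 := abs_le_of_sq_le_sq' h3 (norm_nonneg _)
  linarith [h4.2]

namespace BinaryHierarchy

variable {τ : BinaryHierarchy J}

section Cone

variable {E : Type*} [NormedAddCommGroup E] [InnerProductSpace ℝ E]

/-- The configurations (possibly with collisions) supporting the hierarchy with given separation
directions. -/
def supportCone (u : τ.internal → E) : Set (J → E) :=
  {x | ∀ P : τ.internal,
    (∃ l : ℝ, 0 < l ∧ _root_.centroid x (left P) - _root_.centroid x (right P) = l • u P) ∧
    (∀ i ∈ left P, 0 ≤ ⟪x i - (2 : ℝ)⁻¹ • (_root_.centroid x (left P) +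
      _root_.centroid x (right P)), u P⟫) ∧
    ∀ j ∈ right P, ⟪x j - (2 : ℝ)⁻¹ • (_root_.centroid x (left P) +
      _root_.centroid x (right P)), u P⟫ ≤ 0}

lemma supportCone_combination {u : τ.internal → E} {x y : J → E} (hx : x ∈ supportCone u)
    (hy : y ∈ supportCone u) {a b : ℝ} (ha : 0 ≤ a) (hb : 0 ≤ b) (hab : 0 < a + b) :
    a • x + b • y ∈ supportCone u := by
  intro P
  obtain ⟨⟨l, hl, hxl⟩, hx1, hx2⟩ := hx P
  obtain ⟨⟨m, hm, hym⟩, hy1, hy2⟩ := hy P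
  have key : ∀ i, ⟪(a • x + b • y) i - (2 : ℝ)⁻¹ • (_root_.centroid (a • x + b • y) (left P) +
      _root_.centroid (a • x + b • y) (right P)), u P⟫ =
      a * ⟪x i - (2 : ℝ)⁻¹ • (_root_.centroid x (left P) + _root_.centroid x (right P)), u P⟫ +
      b * ⟪y i - (2 : ℝ)⁻¹ • (_root_.centroid y (left P) + _root_.centroid y (right P)), u P⟫ := by
    intro i
    rw [← real_inner_smul_left, ← real_inner_smul_left, ← inner_add_left, centroid_combination,
      centroid_combination]
    congr 1
    simp only [Pi.add_apply, Pi.smul_apply]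
    module
  refine ⟨⟨a * l + b * m, ?_, ?_⟩, fun i hi => ?_, fun j hj => ?_⟩
  · rcases ha.eq_or_lt with rfl | ha'
    · have : 0 < b := by linarith
      positivity
    · positivity
  · rw [centroid_combination, centroid_combination, add_smul, mul_smul, mul_smul, ← hxl, ← hym]
    module
  · rw [key]
    exact add_nonneg (mul_nonneg ha (hx1 i hi)) (mul_nonneg hb (hy1 i hi))
  · rw [key]
    exact add_nonpos (mul_nonpos_of_nonneg_of_nonpos ha (hx2 j hj))
      (mul_nonpos_of_nonneg_of_nonpos hb (hy2 j hj))

lemma inner_sub_nonneg {u : τ.internal → E} {x : J → E} (hx : x ∈ supportCone u) {P : τ.internal}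
    {i j : J} (hi : i ∈ left P) (hj : j ∈ right P) : 0 ≤ ⟪x i - x j, u P⟫ := by
  have h1 := (hx P).2.1 i hi
  have h2 := (hx P).2.2 j hj
  rw [inner_sub_left] at h1 h2 ⊢
  linarith

variable {r : J → ℝ}

lemma model_mem_supportCone (hr : ∀ j, 0 ≤ r j) {u : τ.internal → E} (hu : ∀ I, ‖u I‖ = 1) :
    model r u ∈ supportCone u := by
  intro P
  have hs := centroid_model_left_sub_right (r := r) u P
  have hW := weight_pos hr P
  have huu : ⟪u P, u P⟫ = 1 := by rw [real_inner_self_eq_norm_sq, hu, one_pow]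
  refine ⟨⟨weight r P, hW, hs⟩, fun i hi => ?_, fun j hj => ?_⟩
  · have e : model r u i - (2 : ℝ)⁻¹ • (_root_.centroid (model r u) (left P) +
        _root_.centroid (model r u) (right P)) =
        (model r u i - _root_.centroid (model r u) (left P)) + (2⁻¹ : ℝ) • weight r P • u P := by
      rw [← hs]
      module
    have h1 := norm_model_sub_centroid_le hr hu P (left_mem P) (left_ssubset P) hi
    have h2 := neg_le_of_abs_le (abs_real_inner_le_norm
      (model r u i - _root_.centroid (model r u) (left P)) (u P))
    rw [hu, mul_one] at h2
    rw [e, inner_add_left, real_inner_smul_left, real_inner_smul_left, huu]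
    linarith
  · have e : model r u j - (2 : ℝ)⁻¹ • (_root_.centroid (model r u) (left P) +
        _root_.centroid (model r u) (right P)) =
        (model r u j - _root_.centroid (model r u) (right P)) - (2⁻¹ : ℝ) • weight r P • u P := by
      rw [← hs]
      module
    have h1 := norm_model_sub_centroid_le hr hu P (right_mem P) (right_ssubset P) hj
    have h2 := le_of_abs_le (abs_real_inner_le_norm
      (model r u j - _root_.centroid (model r u) (right P)) (u P))
    rw [hu, mul_one] at h2
    rw [e, inner_sub_left, real_inner_smul_left, real_inner_smul_left, huu]
    linarith

lemma norm_model_sub_ge (hr : ∀ j, 0 ≤ r j) {u : τ.internal → E} (hu : ∀ I, ‖u I‖ = 1)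
    {P : τ.internal} {i j : J} (hi : i ∈ left P) (hj : j ∈ right P) :
    weight r P / 2 ≤ ‖model r u i - model r u j‖ := by
  have h1 := norm_model_sub_model_sub_le hr hu P hi hj
  have h2 := norm_sub_norm_le (weight r P • u P) (model r u i - model r u j)
  have hW := weight_pos hr P
  rw [norm_smul, hu, mul_one, Real.norm_of_nonneg hW.le, norm_sub_rev (weight r P • u P)] at h2
  linarith

lemma two_mul_add_lt_norm_model_sub (hr : ∀ j, 0 ≤ r j) {u : τ.internal → E}
    (hu : ∀ I, ‖u I‖ = 1) {P : τ.internal} {i j : J} (hi : i ∈ left P) (hj : j ∈ right P) :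
    2 * (r i + r j) < ‖model r u i - model r u j‖ := by
  have h1 := norm_model_sub_ge hr hu hi hj
  have h2 := lt_weight hr P
  have h3 : r i ≤ ∑ k, r k := Finset.single_le_sum (fun k _ => hr k) (Finset.mem_univ i)
  have h4 : r j ≤ ∑ k, r k := Finset.single_le_sum (fun k _ => hr k) (Finset.mem_univ j)
  linarith

lemma inner_sub_model_sub_ge (hr : ∀ j, 0 ≤ r j) {u : τ.internal → E} (hu : ∀ I, ‖u I‖ = 1)
    {x : J → E} (hx : x ∈ supportCone u) {P : τ.internal} {i j : J} (hi : i ∈ left P)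
    (hj : j ∈ right P) :
    -(‖x i - x j‖ * ‖model r u i - model r u j‖ / 2) ≤
      ⟪x i - x j, model r u i - model r u j⟫ := by
  have h1 := norm_model_sub_model_sub_le hr hu P hi hj
  have h2 := norm_model_sub_ge hr hu hi hj
  have h3 := mul_nonneg (weight_pos hr P).le (inner_sub_nonneg hx hi hj)
  have h4 := neg_le_of_abs_le (abs_real_inner_le_norm (x i - x j)
    (model r u i - model r u j - weight r P • u P))
  rw [inner_sub_right, real_inner_smul_right] at h4
  have h5 : ‖x i - x j‖ * ‖model r u i - model r u j - weight r P • u P‖ ≤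
      ‖x i - x j‖ * (‖model r u i - model r u j‖ / 2) := by
    gcongr
    linarith [norm_nonneg (model r u i - model r u j)]
  linarith

end Cone

section Stratum

variable {d : ℕ} {r : J → ℝ}

lemma mem_conf_of_separated {x : J → EuclideanSpace ℝ (Fin d)}
    (h : ∀ (P : τ.internal) (i j : J), i ∈ left P → j ∈ right P → r i + r j < ‖x i - x j‖) :
    x ∈ Conf d J r := by
  intro i j hij
  obtain ⟨P, hP | hP⟩ := exists_separating (τ := τ) hij
  · exact h P i j hP.1 hP.2
  · rw [add_comm, norm_sub_rev]
    exact h P j i hP.1 hP.2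

lemma sepVec_left (x : J → EuclideanSpace ℝ (Fin d)) (P : τ.internal) :
    sepVec τ x (left P) = _root_.centroid x (left P) - _root_.centroid x (right P) := by
  rw [sepVec, sibling_left]

lemma sepVec_right (x : J → EuclideanSpace ℝ (Fin d)) (P : τ.internal) :
    sepVec τ x (right P) = -(_root_.centroid x (left P) - _root_.centroid x (right P)) := by
  rw [sepVec, sibling_right, neg_sub]

lemma midpt_left (x : J → EuclideanSpace ℝ (Fin d)) (P : τ.internal) :
    midpt τ x (left P) =
      (2 : ℝ)⁻¹ • (_root_.centroid x (left P) + _root_.centroid x (right P)) := by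
  rw [midpt, sibling_left]

lemma midpt_right (x : J → EuclideanSpace ℝ (Fin d)) (P : τ.internal) :
    midpt τ x (right P) =
      (2 : ℝ)⁻¹ • (_root_.centroid x (left P) + _root_.centroid x (right P)) := by
  rw [midpt, sibling_right, add_comm]

/-- The unit separation vector of the children of a nonsingleton cluster. -/
noncomputable def direction (x : J → EuclideanSpace ℝ (Fin d)) (P : τ.internal) :
    EuclideanSpace ℝ (Fin d) :=
  ‖sepVec τ x (left P)‖⁻¹ • sepVec τ x (left P)

lemma left_ne_univ (P : τ.internal) : left P ≠ Finset.univ :=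
  fun h => (left_ssubset P).2 (h ▸ Finset.subset_univ _)

lemma right_ne_univ (P : τ.internal) : right P ≠ Finset.univ :=
  fun h => (right_ssubset P).2 (h ▸ Finset.subset_univ _)

lemma sepVec_left_ne_zero {x : J → EuclideanSpace ℝ (Fin d)} (hx : x ∈ stratum d r τ)
    (P : τ.internal) : sepVec τ x (left P) ≠ 0 :=
  (hx.2 _ (left_mem P) (left_ne_univ P)).1

lemma norm_direction {x : J → EuclideanSpace ℝ (Fin d)} (hx : x ∈ stratum d r τ)
    (P : τ.internal) : ‖direction x P‖ = 1 :=
  norm_smul_inv_norm (𝕜 := ℝ) (sepVec_left_ne_zero hx P)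

lemma mem_supportCone_direction {x : J → EuclideanSpace ℝ (Fin d)} (hx : x ∈ stratum d r τ) :
    x ∈ supportCone (τ := τ) (direction x) := by
  intro P
  have hne := norm_pos_iff.2 (sepVec_left_ne_zero hx P)
  refine ⟨⟨_, hne, ?_⟩, fun i hi => ?_, fun j hj => ?_⟩
  · rw [direction, smul_smul, mul_inv_cancel₀ hne.ne', one_smul, sepVec_left]
  · rw [← midpt_left]
    exact (hx.2 _ (left_mem P) (left_ne_univ P)).2 i hi
  · have h := (hx.2 _ (right_mem P) (right_ne_univ P)).2 j hj
    rw [separation, sepVec_right, ← sepVec_left, norm_neg, smul_neg, inner_neg_right,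
      midpt_right] at h
    exact neg_nonneg.1 h

lemma direction_eq {x : J → EuclideanSpace ℝ (Fin d)} {u : τ.internal → EuclideanSpace ℝ (Fin d)}
    (hu : ∀ I, ‖u I‖ = 1) (hx : x ∈ supportCone u) : direction x = u := by
  funext P
  obtain ⟨⟨l, hl, hxl⟩, -⟩ := hx P
  rw [direction, sepVec_left, hxl, norm_smul, hu, mul_one, Real.norm_of_nonneg hl.le, smul_smul,
    inv_mul_cancel₀ hl.ne', one_smul]

lemma mem_stratum {x : J → EuclideanSpace ℝ (Fin d)} {u : τ.internal → EuclideanSpace ℝ (Fin d)}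
    (hu : ∀ I, ‖u I‖ = 1) (hx : x ∈ supportCone u) (hconf : x ∈ Conf d J r) :
    x ∈ stratum d r τ := by
  refine ⟨hconf, fun K hK hne => ?_⟩
  obtain ⟨P, hP⟩ := exists_eq_left_or_eq_right hK hne
  obtain ⟨⟨l, hl, hxl⟩, h1, h2⟩ := hx P
  have hdir : ‖sepVec τ x (left P)‖⁻¹ • sepVec τ x (left P) = u P :=
    congrFun (direction_eq hu hx) P
  have h0 : sepVec τ x (left P) ≠ 0 := by
    rw [sepVec_left, hxl]
    exact smul_ne_zero hl.ne' (norm_ne_zero_iff.1 (by rw [hu]; exact one_ne_zero))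
  rcases hP with rfl | rfl
  · refine ⟨h0, fun i hi => ?_⟩
    rw [separation, hdir, midpt_left]
    exact h1 i hi
  · have hneg : sepVec τ x (right P) = -sepVec τ x (left P) := by
      rw [sepVec_right, sepVec_left]
    refine ⟨by rw [hneg]; exact neg_ne_zero.2 h0, fun j hj => ?_⟩
    rw [separation, hneg, norm_neg, smul_neg, hdir, midpt_right, inner_neg_right]
    exact neg_nonneg.2 (h2 j hj)

lemma model_mem_stratum (hr : ∀ j, 0 ≤ r j) {u : τ.internal → EuclideanSpace ℝ (Fin d)}
    (hu : ∀ I, ‖u I‖ = 1) : model r u ∈ stratum d r τ := by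
  refine mem_stratum hu (model_mem_supportCone hr hu)
    (mem_conf_of_separated (τ := τ) fun P i j hi hj => ?_)
  have := two_mul_add_lt_norm_model_sub hr hu hi hj
  linarith [hr i, hr j]

lemma smul_mem_stratum (hr : ∀ j, 0 ≤ r j) {x : J → EuclideanSpace ℝ (Fin d)}
    (hx : x ∈ stratum d r τ) {a : ℝ} (ha : 1 ≤ a) : a • x ∈ stratum d r τ := by
  refine mem_stratum (norm_direction hx) (u := direction x) ?_ fun i j hij => ?_
  · have h := mem_supportCone_direction hx
    simpa using supportCone_combination h h (a := a) (b := 0) (by linarith) le_rfl (by linarith)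
  · have h := hx.1 i j hij
    rw [Pi.smul_apply, Pi.smul_apply, ← smul_sub, norm_smul, Real.norm_of_nonneg (by linarith)]
    nlinarith [hr i, hr j]

lemma combination_mem_stratum (hr : ∀ j, 0 ≤ r j) {x : J → EuclideanSpace ℝ (Fin d)}
    (hx : x ∈ stratum d r τ) {s t : ℝ} (hs : 0 ≤ s) (ht : 0 ≤ t) (hst : s + t = 1) :
    s • ((2 : ℝ) • x) + t • model r (direction (τ := τ) x) ∈ stratum d r τ := by
  have hu := norm_direction hx
  have hcone : (2 : ℝ) • x ∈ supportCone (direction (τ := τ) x) := by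
    have h := mem_supportCone_direction hx
    simpa using supportCone_combination h h (a := 2) (b := 0) (by norm_num) le_rfl (by norm_num)
  refine mem_stratum hu (supportCone_combination hcone (model_mem_supportCone hr hu) hs ht
    (by linarith)) (mem_conf_of_separated (τ := τ) fun P i j hi hj => ?_)
  have hij : i ≠ j := by
    rintro rfl
    exact Finset.disjoint_left.1 (disjoint_left_right P) hi hj
  have e : (s • ((2 : ℝ) • x) + t • model r (direction (τ := τ) x)) i -
      (s • ((2 : ℝ) • x) + t • model r (direction (τ := τ) x)) j =
      s • (((2 : ℝ) • x) i - ((2 : ℝ) • x) j) +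
        t • (model r (direction (τ := τ) x) i - model r (direction (τ := τ) x) j) := by
    simp only [Pi.add_apply, Pi.smul_apply]
    module
  rw [e]
  refine norm_convex_combination_gt hs ht hst ?_ (two_mul_add_lt_norm_model_sub hr hu hi hj)
    (inner_sub_model_sub_ge hr hu hcone hi hj)
  rw [Pi.smul_apply, Pi.smul_apply, ← smul_sub, norm_smul, Real.norm_of_nonneg zero_le_two]
  linarith [hx.1 i j hij]

lemma continuous_direction :
    Continuous fun (x : stratum d r τ) (P : τ.internal) => direction x.1 P := by
  refine continuous_pi fun P => ?_
  have h : Continuous fun x : stratum d r τ => sepVec τ x.1 (left P) := by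
    unfold sepVec _root_.centroid
    fun_prop
  exact (h.norm.inv₀ fun x => norm_ne_zero_iff.2 (sepVec_left_ne_zero x.2 P)).smul h

/-- The separation directions of a configuration, as a map to a product of spheres. -/
noncomputable def directionMap (d : ℕ) (r : J → ℝ) (τ : BinaryHierarchy J) :
    C(stratum d r τ, τ.internal → Metric.sphere (0 : EuclideanSpace ℝ (Fin d)) 1) where
  toFun x P := ⟨direction x.1 P, mem_sphere_zero_iff_norm.2 (norm_direction x.2 P)⟩
  continuous_toFun := continuous_pi fun P =>
    ((continuous_apply P).comp continuous_direction).subtype_mk _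

/-- The well-separated configurations, as a section of `directionMap`. -/
noncomputable def modelMap (hr : ∀ j, 0 ≤ r j) :
    C(τ.internal → Metric.sphere (0 : EuclideanSpace ℝ (Fin d)) 1, stratum d r τ) where
  toFun u := ⟨model r fun P => (u P : EuclideanSpace ℝ (Fin d)),
    model_mem_stratum hr fun P => mem_sphere_zero_iff_norm.1 (u P).2⟩
  continuous_toFun := by
    refine Continuous.subtype_mk ?_ _
    unfold model
    fun_prop

/-- Scaling by two, as a self-map of the stratum. -/
noncomputable def doubleMap (hr : ∀ j, 0 ≤ r j) : C(stratum d r τ, stratum d r τ) where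
  toFun x := ⟨(2 : ℝ) • x.1, smul_mem_stratum hr x.2 one_le_two⟩
  continuous_toFun := (continuous_subtype_val.const_smul (2 : ℝ)).subtype_mk _

lemma homotopic_id_doubleMap (hr : ∀ j, 0 ≤ r j) :
    (ContinuousMap.id (stratum d r τ)).Homotopic (doubleMap hr) :=
  ⟨{ toFun := fun p => ⟨(1 + (p.1 : ℝ)) • p.2.1,
        smul_mem_stratum hr p.2.2 (le_add_of_nonneg_right p.1.2.1)⟩
     continuous_toFun := by
        refine Continuous.subtype_mk ?_ _
        fun_prop
     map_zero_left := fun x => Subtype.ext (by simp)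
     map_one_left := fun x => Subtype.ext (by simp [doubleMap, one_add_one_eq_two]) }⟩

lemma homotopic_doubleMap_modelMap (hr : ∀ j, 0 ≤ r j) :
    (doubleMap hr).Homotopic ((modelMap hr).comp (directionMap d r τ)) :=
  ⟨{ toFun := fun p => ⟨(1 - (p.1 : ℝ)) • ((2 : ℝ) • p.2.1) +
          (p.1 : ℝ) • model r (direction (τ := τ) p.2.1),
        combination_mem_stratum hr p.2.2 (sub_nonneg.2 p.1.2.2) p.1.2.1 (sub_add_cancel _ _)⟩
     continuous_toFun := by
        have h : Continuous fun p : unitInterval × stratum d r τ =>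
            model r (direction (τ := τ) p.2.1) :=
          continuous_subtype_val.comp
            (((modelMap hr).comp (directionMap d r τ)).continuous.comp continuous_snd)
        refine Continuous.subtype_mk ?_ _
        fun_prop
     map_zero_left := fun x => Subtype.ext (by simp [doubleMap])
     map_one_left := fun x => Subtype.ext (by simp [modelMap, directionMap]) }⟩

lemma directionMap_comp_modelMap (hr : ∀ j, 0 ≤ r j) :
    (directionMap d r τ).comp (modelMap hr) = ContinuousMap.id _ := by
  ext1 u
  funext P
  have hu : ∀ I, ‖(u I : EuclideanSpace ℝ (Fin d))‖ = 1 :=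
    fun I => mem_sphere_zero_iff_norm.1 (u I).2
  exact Subtype.ext (congrFun (direction_eq hu (model_mem_supportCone hr hu)) P)

/-- A stratum is homotopy equivalent to the product of the spheres of separation directions. -/
noncomputable def stratumHomotopyEquiv (hr : ∀ j, 0 ≤ r j) :
    ContinuousMap.HomotopyEquiv (stratum d r τ)
      (τ.internal → Metric.sphere (0 : EuclideanSpace ℝ (Fin d)) 1) where
  toFun := directionMap d r τ
  invFun := modelMap hr
  left_inv := ((homotopic_id_doubleMap hr).trans (homotopic_doubleMap_modelMap hr)).symm
  right_inv := by
    rw [directionMap_comp_modelMap]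

end Stratum

end BinaryHierarchy

/-- the stratum of disk configurations supporting a binary hierarchy `τ`
is homotopy equivalent to `(S^{d-1})^{n-1}`. -/
theorem stratum_homotopy_equivalent_spheres (d : ℕ) (hd : 1 ≤ d)
    (hn : 1 ≤ Fintype.card J) (r : J → ℝ) (hr : ∀ j, 0 ≤ r j)
    (τ : BinaryHierarchy J) :
    Nonempty (ContinuousMap.HomotopyEquiv (↑(stratum d r τ))
      (Fin (Fintype.card J - 1) → Metric.sphere (0 : EuclideanSpace ℝ (Fin d)) 1)) := by
  have e : τ.internal ≃ Fin (Fintype.card J - 1) :=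
    Fintype.equivFinOfCardEq BinaryHierarchy.card_internal
  exact ⟨(BinaryHierarchy.stratumHomotopyEquiv hr).trans
    (Homeomorph.piCongrLeft (Y := fun _ => Metric.sphere (0 : EuclideanSpace ℝ (Fin d)) 1)
      e).toHomotopyEquiv⟩
end

section
/- Let J be a finite index set, let d ≥ 2, let r = (r_j)_{j∈J} be nonnegative radii, and let τ be a binary hierarchy over J. Then the stratum S(τ) ⊆ Conf(ℝᵈ, J, r) is path-connected. -/
open Finset

variable {J : Type*} [DecidableEq J] [Fintype J]

open scoped RealInnerProductSpace

section Split

variable {E : Type*} [NormedAddCommGroup E] [InnerProductSpace ℝ E]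

lemma centroid_eq_add {A : Finset J} (hA : A.Nonempty) {x y : J → E} {v : E}
    (h : ∀ i ∈ A, y i = x i + v) : centroid y A = centroid x A + v := by
  have hc : (A.card : ℝ) ≠ 0 := by exact_mod_cast hA.card_pos.ne'
  unfold _root_.centroid
  rw [Finset.sum_congr rfl h, Finset.sum_add_distrib, Finset.sum_const, smul_add,
    ← Nat.cast_smul_eq_nsmul ℝ, smul_smul, inv_mul_cancel₀ hc, one_smul]

lemma continuous_centroid (A : Finset J) : Continuous fun x : J → E => centroid x A := by
  unfold _root_.centroid
  fun_prop

/-- The points of `x` labelled by `L` lie weakly on the `L`-side of the hyperplane bisecting the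
segment between the (distinct) centroids of `L` and `R`. -/
def OnSide (x : J → E) (L R : Finset J) : Prop :=
  centroid x L - centroid x R ≠ 0 ∧
    ∀ i ∈ L, 0 ≤ ⟪x i - (2 : ℝ)⁻¹ • (centroid x L + centroid x R), centroid x L - centroid x R⟫

/-- The clusters `L` and `R` are separated in `x` by their bisecting hyperplane, and no disk
of `L` collides with a disk of `R`. -/
def Apart (r : J → ℝ) (L R : Finset J) (x : J → E) : Prop :=
  OnSide x L R ∧ OnSide x R L ∧ ∀ i ∈ L, ∀ j ∈ R, r i + r j < ‖x i - x j‖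

lemma OnSide.of_add {L R : Finset J} {x y : J → E} (h : OnSide x L R) (hL : L.Nonempty)
    (hR : R.Nonempty) {a b : E} {k : ℝ} (hk : 0 ≤ k) (hya : ∀ i ∈ L, y i = x i + a)
    (hyb : ∀ i ∈ R, y i = x i + b) (hab : a - b = k • (centroid x L - centroid x R)) :
    OnSide y L R := by
  obtain ⟨hs, h⟩ := h
  have ha : a = b + k • (centroid x L - centroid x R) := by rw [← hab]; abel
  have key : centroid y L - centroid y R = (1 + k) • (centroid x L - centroid x R) := by
    rw [centroid_eq_add hL hya, centroid_eq_add hR hyb, ha]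
    module
  refine ⟨?_, fun i hi => ?_⟩
  · rw [key]
    exact smul_ne_zero (by positivity) hs
  · have hm : y i - (2 : ℝ)⁻¹ • (centroid y L + centroid y R) =
        (x i - (2 : ℝ)⁻¹ • (centroid x L + centroid x R)) +
          (k / 2) • (centroid x L - centroid x R) := by
      rw [centroid_eq_add hL hya, centroid_eq_add hR hyb, hya i hi, ha]
      module
    rw [key, hm, inner_smul_right, inner_add_left, real_inner_smul_left,
      real_inner_self_eq_norm_sq]
    have := h i hi
    positivity

lemma Apart.of_add {r : J → ℝ} {L R : Finset J} {x y : J → E} (h : Apart r L R x)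
    (hL : L.Nonempty) (hR : R.Nonempty) {a b : E} {k : ℝ} (hk : 0 ≤ k)
    (hya : ∀ i ∈ L, y i = x i + a) (hyb : ∀ i ∈ R, y i = x i + b)
    (hab : a - b = k • (centroid x L - centroid x R)) : Apart r L R y := by
  obtain ⟨h₁, h₂, h₃⟩ := h
  refine ⟨h₁.of_add hL hR hk hya hyb hab, h₂.of_add hR hL hk hyb hya ?_, fun i hi j hj => ?_⟩
  · rw [← neg_sub a b, hab]
    module
  · refine (h₃ i hi j hj).trans_le ?_
    set s := centroid x L - centroid x R with hs
    have hij : y i - y j = (x i - x j) + k • s := by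
      rw [hya i hi, hyb j hj, ← hab]
      abel
    have hinner : 0 ≤ ⟪x i - x j, s⟫ := by
      have e₁ := h₁.2 i hi
      have e₂ := h₂.2 j hj
      have e : ⟪x i - x j, s⟫ =
          ⟪x i - (2 : ℝ)⁻¹ • (centroid x L + centroid x R), centroid x L - centroid x R⟫ +
          ⟪x j - (2 : ℝ)⁻¹ • (centroid x R + centroid x L), centroid x R - centroid x L⟫ := by
        rw [← neg_sub (centroid x L) (centroid x R), inner_neg_right, ← sub_eq_add_neg,
          ← inner_sub_left]
        congr 1
        module
      rw [e]
      exact add_nonneg e₁ e₂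
    rw [hij]
    refine le_of_sq_le_sq ?_ (norm_nonneg _)
    rw [norm_add_sq_real, inner_smul_right]
    nlinarith [mul_nonneg hk hinner, sq_nonneg ‖k • s‖]

lemma OnSide.of_norm_le {L R : Finset J} {x : J → E} {M : ℝ}
    (hs : centroid x L - centroid x R ≠ 0)
    (hL : ∀ i ∈ L, ‖x i - centroid x L‖ ≤ M)
    (hM : 2 * M ≤ ‖centroid x L - centroid x R‖) : OnSide x L R := by
  refine ⟨hs, fun i hi => ?_⟩
  set s := centroid x L - centroid x R with hsdef
  have hm : x i - (2 : ℝ)⁻¹ • (centroid x L + centroid x R) =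
      (x i - centroid x L) + (2 : ℝ)⁻¹ • s := by
    rw [hsdef]
    module
  rw [hm, inner_add_left, real_inner_smul_left, real_inner_self_eq_norm_sq]
  have h₁ := (abs_le.1 (abs_real_inner_le_norm (x i - centroid x L) s)).1
  have h₂ := mul_le_mul_of_nonneg_right (hL i hi) (norm_nonneg s)
  nlinarith [mul_le_mul_of_nonneg_right hM (norm_nonneg s)]

lemma Apart.of_norm_le {r : J → ℝ} {L R : Finset J} {x : J → E} {M : ℝ}
    (hs : centroid x L - centroid x R ≠ 0)
    (hL : ∀ i ∈ L, ‖x i - centroid x L‖ ≤ M) (hR : ∀ i ∈ R, ‖x i - centroid x R‖ ≤ M)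
    (hM : 2 * M ≤ ‖centroid x L - centroid x R‖)
    (hr : ∀ i j, 2 * M + (r i + r j) < ‖centroid x L - centroid x R‖) : Apart r L R x := by
  refine ⟨.of_norm_le hs hL hM, .of_norm_le ?_ hR ?_, fun i hi j hj => ?_⟩
  · rwa [← neg_sub, neg_ne_zero]
  · rwa [norm_sub_rev]
  · have h : centroid x L - centroid x R =
        (x i - x j) - (x i - centroid x L) + (x j - centroid x R) := by abel
    have h₁ := norm_add_le ((x i - x j) - (x i - centroid x L)) (x j - centroid x R)
    have h₂ := norm_sub_le (x i - x j) (x i - centroid x L)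
    rw [← h] at h₁
    linarith [hr i j, hL i hi, hR j hj]

/-- The configuration whose part labelled by `L` is a translate of `p`, whose part labelled by
`R` is a translate of `q`, and whose centroids of `L` and `R` are `s / 2` and `-s / 2`. -/
noncomputable def place (L R : Finset J) (p q : J → E) (s : E) : J → E := fun i =>
  if i ∈ L then p i - centroid p L + (2 : ℝ)⁻¹ • s
  else if i ∈ R then q i - centroid q R - (2 : ℝ)⁻¹ • s else 0

lemma continuous_place (L R : Finset J) :
    Continuous fun z : (J → E) × (J → E) × E => place L R z.1 z.2.1 z.2.2 := by
  have h := continuous_centroid (E := E) L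
  have h' := continuous_centroid (E := E) R
  have h₁ : Continuous fun z : (J → E) × (J → E) × E => centroid z.1 L := by fun_prop
  have h₂ : Continuous fun z : (J → E) × (J → E) × E => centroid z.2.1 R := by fun_prop
  refine continuous_pi fun i => ?_
  unfold place
  split_ifs <;> fun_prop

lemma place_left {L R : Finset J} {p q : J → E} {s : E} {i : J} (hi : i ∈ L) :
    place L R p q s i = p i + ((2 : ℝ)⁻¹ • s - centroid p L) := by
  simp only [place, if_pos hi]
  abel

lemma place_right {L R : Finset J} (hLR : Disjoint L R) {p q : J → E} {s : E} {i : J}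
    (hi : i ∈ R) : place L R p q s i = q i + (-(2 : ℝ)⁻¹ • s - centroid q R) := by
  simp only [place, if_neg (Finset.disjoint_right.1 hLR hi), if_pos hi]
  module

lemma centroid_place_left {L R : Finset J} (hL : L.Nonempty) (p q : J → E) (s : E) :
    centroid (place L R p q s) L = (2 : ℝ)⁻¹ • s := by
  rw [centroid_eq_add hL fun i hi => place_left hi]
  abel

lemma centroid_place_right {L R : Finset J} (hLR : Disjoint L R) (hR : R.Nonempty)
    (p q : J → E) (s : E) : centroid (place L R p q s) R = -(2 : ℝ)⁻¹ • s := by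
  rw [centroid_eq_add hR fun i hi => place_right hLR hi]
  abel

lemma apart_place {r : J → ℝ} {L R : Finset J} (hLR : Disjoint L R) (hL : L.Nonempty)
    (hR : R.Nonempty) {p q : J → E} {s : E} {M : ℝ} (hs : s ≠ 0)
    (hp : ∀ i, ‖p i - centroid p L‖ ≤ M) (hq : ∀ i, ‖q i - centroid q R‖ ≤ M)
    (hM : 2 * M ≤ ‖s‖) (hr : ∀ i j, 2 * M + (r i + r j) < ‖s‖) :
    Apart r L R (place L R p q s) := by
  have key : centroid (place L R p q s) L - centroid (place L R p q s) R = s := by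
    rw [centroid_place_left hL, centroid_place_right hLR hR]
    module
  refine .of_norm_le (M := M) (by rwa [key]) (fun i hi => ?_) (fun i hi => ?_)
    (by rwa [key]) (by rwa [key])
  · rw [centroid_place_left hL, place_left hi]
    convert hp i using 2
    abel
  · rw [centroid_place_right hLR hR, place_right hLR hi]
    convert hq i using 2
    abel

/-- A property of configurations depending only on the part labelled by `L`, up to translation. -/
def IsLocalOn (L : Finset J) (A : Set (J → E)) : Prop :=
  ∀ x ∈ A, ∀ (y : J → E) (v : E), (∀ i ∈ L, y i = x i + v) → y ∈ A

lemma exists_norm_path_sub_centroid_le (A : Finset J) {x y : J → E} (γ : Path x y) :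
    ∃ M, ∀ t i, ‖γ t i - centroid (γ t) A‖ ≤ M := by
  have hc := continuous_centroid (E := E) A
  have hcont : Continuous fun t => fun i => γ t i - centroid (γ t) A := by
    have hγ := γ.continuous
    have : Continuous fun t => centroid (γ t) A := hc.comp hγ
    fun_prop
  obtain ⟨M, hM⟩ := (isCompact_range hcont).isBounded.exists_norm_le
  exact ⟨M, fun t i => (norm_le_pi_norm (fun i => γ t i - centroid (γ t) A) i).trans
    (hM _ ⟨t, rfl⟩)⟩

/-- A bound on the distance between centroids beyond which `place` gives separated clusters. -/
lemma exists_apart_place (r : J → ℝ) {L R : Finset J} (hLR : Disjoint L R) (hL : L.Nonempty)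
    (hR : R.Nonempty) (M : ℝ) : ∃ N, ∀ p q : J → E, (∀ i, ‖p i - centroid p L‖ ≤ M) →
      (∀ i, ‖q i - centroid q R‖ ≤ M) → ∀ s, N ≤ ‖s‖ → Apart r L R (place L R p q s) := by
  obtain ⟨C, hC⟩ := (Set.finite_range fun z : J × J => r z.1 + r z.2).bddAbove
  refine ⟨2 * |M| + |C| + 1, fun p q hp hq s hs => ?_⟩
  have h₁ := abs_nonneg M
  have h₂ := abs_nonneg C
  have h₃ := le_abs_self M
  have h₄ := le_abs_self C
  refine apart_place hLR hL hR (norm_pos_iff.1 (by linarith)) hp hq (by linarith)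
    fun i j => ?_
  have h₅ : r i + r j ≤ C := hC ⟨(i, j), rfl⟩
  linarith

variable {A B : Set (J → E)} {r : J → ℝ} {L R : Finset J}

lemma place_mem (hA : IsLocalOn L A) (hB : IsLocalOn R B) (hLR : Disjoint L R) {p q : J → E}
    (hp : p ∈ A) (hq : q ∈ B) (s : E) : place L R p q s ∈ A ∩ B :=
  ⟨hA p hp _ _ fun _ hi => place_left hi, hB q hq _ _ fun _ hi => place_right hLR hi⟩

lemma joinedIn_place (hA : IsLocalOn L A) (hB : IsLocalOn R B) (hLR : Disjoint L R)
    (hL : L.Nonempty) (hR : R.Nonempty) {x : J → E} (hx : x ∈ A ∩ B ∩ {x | Apart r L R x})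
    {c : ℝ} (hc : 1 ≤ c) :
    JoinedIn (A ∩ B ∩ {x | Apart r L R x}) x
      (place L R x x (c • (centroid x L - centroid x R))) := by
  set s := centroid x L - centroid x R with hs
  set y := place L R x x (c • s) with hy
  refine JoinedIn.ofLine (f := fun t : ℝ => x + t • (y - x)) (by fun_prop) (by simp) (by simp) ?_
  rintro _ ⟨t, ⟨ht, -⟩, rfl⟩
  have hl : ∀ i ∈ L, (x + t • (y - x)) i = x i + t • ((2 : ℝ)⁻¹ • c • s - centroid x L) := by
    intro i hi
    simp only [Pi.add_apply, Pi.smul_apply, Pi.sub_apply, hy, place_left hi]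
    module
  have hr' : ∀ i ∈ R, (x + t • (y - x)) i = x i + t • (-(2 : ℝ)⁻¹ • c • s - centroid x R) := by
    intro i hi
    simp only [Pi.add_apply, Pi.smul_apply, Pi.sub_apply, hy, place_right hLR hi]
    module
  refine ⟨⟨hA x hx.1.1 _ _ hl, hB x hx.1.2 _ _ hr'⟩, ?_⟩
  refine hx.2.of_add hL hR (k := t * (c - 1)) (mul_nonneg ht (by linarith)) hl hr' ?_
  rw [hs]
  module

theorem isPathConnected_inter_apart (hrank : 1 < Module.rank ℝ E) (hA : IsLocalOn L A)
    (hB : IsLocalOn R B) (hLR : Disjoint L R) (hL : L.Nonempty) (hR : R.Nonempty)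
    (hpA : IsPathConnected A) (hpB : IsPathConnected B) :
    IsPathConnected (A ∩ B ∩ {x | Apart r L R x}) := by
  have hsphere : ∀ N : ℝ, 0 ≤ N → IsPathConnected (Metric.sphere (0 : E) N) :=
    fun N hN => isPathConnected_sphere hrank 0 hN
  rw [isPathConnected_iff]
  constructor
  · obtain ⟨p, hp⟩ := hpA.nonempty
    obtain ⟨q, hq⟩ := hpB.nonempty
    obtain ⟨M, hM⟩ := exists_norm_path_sub_centroid_le L (Path.refl p)
    obtain ⟨M', hM'⟩ := exists_norm_path_sub_centroid_le R (Path.refl q)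
    obtain ⟨N, hN⟩ := exists_apart_place (E := E) r hLR hL hR (max M M')
    obtain ⟨s, hs⟩ := (hsphere |N| (abs_nonneg N)).nonempty
    refine ⟨place L R p q s, place_mem hA hB hLR hp hq s, hN p q
      (fun i => (hM 0 i).trans (le_max_left _ _)) (fun i => (hM' 0 i).trans (le_max_right _ _))
      s ?_⟩
    rw [mem_sphere_zero_iff_norm.1 hs]
    exact le_abs_self N
  · intro x hx y hy
    obtain ⟨α, hα⟩ := hpA.joinedIn x hx.1.1 y hy.1.1
    obtain ⟨β, hβ⟩ := hpB.joinedIn x hx.1.2 y hy.1.2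
    obtain ⟨M, hM⟩ := exists_norm_path_sub_centroid_le L α
    obtain ⟨M', hM'⟩ := exists_norm_path_sub_centroid_le R β
    obtain ⟨N, hN⟩ := exists_apart_place (E := E) r hLR hL hR (max M M')
    set s := centroid x L - centroid x R with hs
    set s' := centroid y L - centroid y R with hs'
    have hspos : 0 < ‖s‖ := norm_pos_iff.2 hx.2.1.1
    have hspos' : 0 < ‖s'‖ := norm_pos_iff.2 hy.2.1.1
    set ρ := max N (max ‖s‖ ‖s'‖) with hρ
    have hρs : ‖s‖ ≤ ρ := (le_max_left _ _).trans (le_max_right _ _)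
    have hρs' : ‖s'‖ ≤ ρ := (le_max_right _ _).trans (le_max_right _ _)
    have hρ0 : 0 ≤ ρ := (norm_nonneg s).trans hρs
    have hmem : ∀ v : E, 0 < ‖v‖ → (ρ / ‖v‖) • v ∈ Metric.sphere (0 : E) ρ := fun v hv => by
      rw [mem_sphere_zero_iff_norm, norm_smul, Real.norm_of_nonneg (by positivity),
        div_mul_cancel₀ _ hv.ne']
    obtain ⟨σ, hσ⟩ := (hsphere ρ hρ0).joinedIn _ (hmem s hspos) _ (hmem s' hspos')
    have hmid : JoinedIn (A ∩ B ∩ {x | Apart r L R x})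
        (place L R x x ((ρ / ‖s‖) • s)) (place L R y y ((ρ / ‖s'‖) • s')) := by
      refine ⟨(α.prod (β.prod σ)).map (continuous_place L R), fun t => ?_⟩
      refine ⟨place_mem hA hB hLR (hα t) (hβ t) (σ t), hN (α t) (β t)
        (fun i => (hM t i).trans (le_max_left _ _)) (fun i => (hM' t i).trans (le_max_right _ _))
        (σ t) ?_⟩
      rw [mem_sphere_zero_iff_norm.1 (hσ t)]
      exact le_max_left _ _
    exact ((joinedIn_place hA hB hLR hL hR hx ((one_le_div hspos).2 hρs)).trans hmid).trans
      (joinedIn_place hA hB hLR hL hR hy ((one_le_div hspos').2 hρs')).symm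

end Split

namespace BinaryHierarchy

variable (τ : BinaryHierarchy J)

lemma subset_or_subset {L R K : Finset J} (hL : L ∈ τ.clusters) (hR : R ∈ τ.clusters)
    (hK : K ∈ τ.clusters) (hsub : K ⊂ L ∪ R) : K ⊆ L ∨ K ⊆ R := by
  obtain ⟨a, ha⟩ := τ.nonempty_of_mem K hK
  rcases τ.laminar K hK L hL with h | h | h
  · exact .inl h
  · rcases τ.laminar K hK R hR with h' | h' | h'
    · exact .inr h'
    · exact absurd (Finset.union_subset h h') hsub.2
    · refine .inl fun i hi => ?_
      exact (Finset.mem_union.1 (hsub.1 hi)).resolve_right (Finset.disjoint_left.1 h' hi)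
  · refine .inr fun i hi => ?_
    exact (Finset.mem_union.1 (hsub.1 hi)).resolve_left (Finset.disjoint_left.1 h hi)

lemma sibling_eq {L R : Finset J} (hL : L ∈ τ.clusters) (hR : R ∈ τ.clusters)
    (hLR : Disjoint L R) (hI : L ∪ R ∈ τ.clusters) : τ.sibling L = R := by
  have hLI : L ⊂ L ∪ R := by
    obtain ⟨b, hb⟩ := τ.nonempty_of_mem R hR
    refine (Finset.ssubset_iff_of_subset Finset.subset_union_left).2
      ⟨b, Finset.mem_union_right _ hb, Finset.disjoint_right.1 hLR hb⟩
  have hpar : τ.parent L = L ∪ R := by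
    refine le_antisymm (Finset.inf_le (f := id) (by simp [hI, hLI])) (Finset.le_inf ?_)
    intro K hK
    obtain ⟨hK, hLK⟩ := Finset.mem_filter.1 hK
    obtain ⟨a, ha⟩ := τ.nonempty_of_mem L hL
    by_contra hcon
    rcases τ.laminar _ hI K hK with h | h | h
    · exact hcon h
    · rcases τ.subset_or_subset hL hR hK ⟨h, hcon⟩ with h' | h'
      · exact hLK.2 h'
      · exact Finset.disjoint_left.1 hLR ha (h' (hLK.1 ha))
    · exact Finset.disjoint_left.1 h (hLI.1 ha) (hLK.1 ha)
  rw [sibling, hpar, Finset.union_sdiff_cancel_left hLR]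

lemma exists_sibling {K : Finset J} (hK : K ∈ τ.clusters) (hne : K ≠ Finset.univ) :
    ∃ R ∈ τ.clusters, Disjoint K R ∧ K ∪ R ∈ τ.clusters := by
  have hmem : Finset.univ ∈ τ.clusters.filter fun I => K ⊂ I :=
    Finset.mem_filter.2 ⟨τ.root_mem, Finset.ssubset_univ_iff.2 hne⟩
  obtain ⟨I, -, hI⟩ := Finset.exists_le_minimal _ hmem
  obtain ⟨hIc, hKI⟩ := Finset.mem_filter.1 hI.prop
  have hcard : 1 < I.card :=
    lt_of_le_of_lt (Finset.card_pos.2 (τ.nonempty_of_mem K hK)) (Finset.card_lt_card hKI)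
  obtain ⟨L, hL, R, hR, hLR, rfl⟩ := τ.binary_split I hIc hcard
  have aux : ∀ {L R : Finset J}, L ∈ τ.clusters → R ∈ τ.clusters → Disjoint L R →
      (Minimal (· ∈ τ.clusters.filter fun I => K ⊂ I) (L ∪ R)) → K ⊆ L → K = L := by
    intro L R hL hR hLR hmin hKL
    by_contra hne
    have hle := hmin.le_of_le (y := L)
      (Finset.mem_filter.2 ⟨hL, hKL.ssubset_of_ne hne⟩) Finset.subset_union_left
    obtain ⟨b, hb⟩ := τ.nonempty_of_mem R hR
    exact Finset.disjoint_right.1 hLR hb (hle (Finset.mem_union_right _ hb))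
  rcases τ.subset_or_subset hL hR hK hKI with h | h
  · obtain rfl := aux hL hR hLR hI h
    exact ⟨R, hR, hLR, hIc⟩
  · rw [Finset.union_comm] at hI hIc
    obtain rfl := aux hR hL hLR.symm hI h
    exact ⟨L, hL, hLR.symm, hIc⟩

/-- The configurations satisfying the conditions of the stratum of `τ` that involve only
points labelled by `I`. -/
def localStratum (E : Type*) [NormedAddCommGroup E] [InnerProductSpace ℝ E] (r : J → ℝ)
    (I : Finset J) : Set (J → E) :=
  {x | (∀ i ∈ I, ∀ j ∈ I, i ≠ j → r i + r j < ‖x i - x j‖) ∧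
    ∀ L ∈ τ.clusters, ∀ R ∈ τ.clusters, Disjoint L R → L ∪ R ∈ τ.clusters → L ∪ R ⊆ I →
      OnSide x L R}

variable {E : Type*} [NormedAddCommGroup E] [InnerProductSpace ℝ E]

lemma isLocalOn_localStratum (r : J → ℝ) (I : Finset J) :
    IsLocalOn I (τ.localStratum E r I) := by
  rintro x ⟨hx₁, hx₂⟩ y v hy
  refine ⟨fun i hi j hj hij => ?_, fun L hL R hR hLR hU hsub => ?_⟩
  · rw [hy i hi, hy j hj, add_sub_add_right_eq_sub]
    exact hx₁ i hi j hj hij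
  · exact (hx₂ L hL R hR hLR hU hsub).of_add (τ.nonempty_of_mem L hL) (τ.nonempty_of_mem R hR)
      le_rfl (fun i hi => hy i (hsub (Finset.mem_union_left _ hi)))
      (fun i hi => hy i (hsub (Finset.mem_union_right _ hi))) (by simp)

lemma eq_or_eq_of_union_eq {L R L' R' : Finset J} (hL : L ∈ τ.clusters) (hR : R ∈ τ.clusters)
    (hL' : L' ∈ τ.clusters) (hR' : R' ∈ τ.clusters) (hLR : Disjoint L R)
    (hLR' : Disjoint L' R') (h : L' ∪ R' = L ∪ R) :
    (L' = L ∧ R' = R) ∨ (L' = R ∧ R' = L) := by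
  have aux : ∀ {A B : Finset J}, A ∈ τ.clusters → B ∈ τ.clusters → Disjoint A B → A ⊂ A ∪ B := by
    intro A B hA hB hAB
    obtain ⟨b, hb⟩ := τ.nonempty_of_mem B hB
    exact (Finset.ssubset_iff_of_subset Finset.subset_union_left).2
      ⟨b, Finset.mem_union_right _ hb, Finset.disjoint_right.1 hAB hb⟩
  have cover : ∀ {A B A' B' : Finset J}, Disjoint A B → A' ∪ B' = A ∪ B → A' ⊆ A → B' ⊆ B →
      A' = A ∧ B' = B := by
    intro A B A' B' hAB hU hA hB
    refine ⟨hA.antisymm fun i hi => ?_, hB.antisymm fun i hi => ?_⟩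
    · have : i ∈ A' ∪ B' := hU ▸ Finset.mem_union_left _ hi
      exact (Finset.mem_union.1 this).resolve_right
        fun hi' => Finset.disjoint_left.1 hAB hi (hB hi')
    · have : i ∈ A' ∪ B' := hU ▸ Finset.mem_union_right _ hi
      exact (Finset.mem_union.1 this).resolve_left
        fun hi' => Finset.disjoint_left.1 hAB (hA hi') hi
  have h₁ := τ.subset_or_subset hL hR hL' (h ▸ aux hL' hR' hLR')
  have h₂ := τ.subset_or_subset hL hR hR'
    (h ▸ Finset.union_comm R' L' ▸ aux hR' hL' hLR'.symm)
  rcases h₁ with h₁ | h₁ <;> rcases h₂ with h₂ | h₂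
  · exact absurd (h ▸ Finset.union_subset h₁ h₂) (aux hL hR hLR).2
  · exact .inl (cover hLR h h₁ h₂)
  · exact .inr (cover hLR.symm (h.trans (Finset.union_comm _ _)) h₁ h₂)
  · exact absurd (h ▸ Finset.union_subset h₁ h₂)
      (Finset.union_comm R L ▸ aux hR hL hLR.symm).2

lemma localStratum_union (r : J → ℝ) {L R : Finset J} (hL : L ∈ τ.clusters)
    (hR : R ∈ τ.clusters) (hLR : Disjoint L R) (hI : L ∪ R ∈ τ.clusters) :
    τ.localStratum E r (L ∪ R) =
      τ.localStratum E r L ∩ τ.localStratum E r R ∩ {x | Apart r L R x} := by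
  ext x
  constructor
  · rintro ⟨h₁, h₂⟩
    have hl := Finset.subset_union_left (s₁ := L) (s₂ := R)
    have hr := Finset.subset_union_right (s₁ := L) (s₂ := R)
    refine ⟨⟨⟨fun i hi j hj => h₁ i (hl hi) j (hl hj), fun L' hL' R' hR' hd hu hs =>
      h₂ L' hL' R' hR' hd hu (hs.trans hl)⟩, ⟨fun i hi j hj => h₁ i (hr hi) j (hr hj),
      fun L' hL' R' hR' hd hu hs => h₂ L' hL' R' hR' hd hu (hs.trans hr)⟩⟩,
      h₂ L hL R hR hLR hI subset_rfl, h₂ R hR L hL hLR.symm ?_ ?_, fun i hi j hj =>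
      h₁ i (hl hi) j (hr hj) ?_⟩
    · rwa [Finset.union_comm]
    · rw [Finset.union_comm]
    · rintro rfl
      exact Finset.disjoint_left.1 hLR hi hj
  · rintro ⟨⟨⟨hL₁, hL₂⟩, ⟨hR₁, hR₂⟩⟩, hLs, hRs, hc⟩
    refine ⟨fun i hi j hj hij => ?_, fun L' hL' R' hR' hd hu hs => ?_⟩
    · rcases Finset.mem_union.1 hi with hi | hi <;> rcases Finset.mem_union.1 hj with hj | hj
      · exact hL₁ i hi j hj hij
      · exact hc i hi j hj
      · rw [add_comm, norm_sub_rev]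
        exact hc j hj i hi
      · exact hR₁ i hi j hj hij
    · by_cases he : L' ∪ R' = L ∪ R
      · rcases τ.eq_or_eq_of_union_eq hL hR hL' hR' hLR hd he with ⟨rfl, rfl⟩ | ⟨rfl, rfl⟩
        · exact hLs
        · exact hRs
      · rcases τ.subset_or_subset hL hR hu (hs.ssubset_of_ne he) with h | h
        · exact hL₂ L' hL' R' hR' hd hu h
        · exact hR₂ L' hL' R' hR' hd hu h

lemma isPathConnected_localStratum (hrank : 1 < Module.rank ℝ E) (r : J → ℝ) (I : Finset J)
    (hI : I ∈ τ.clusters) : IsPathConnected (τ.localStratum E r I) := by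
  induction I using Finset.strongInduction with
  | H I ih =>
    by_cases hcard : 1 < I.card
    · obtain ⟨L, hL, R, hR, hLR, rfl⟩ := τ.binary_split I hI hcard
      have hLn := τ.nonempty_of_mem L hL
      have hRn := τ.nonempty_of_mem R hR
      have hLI : L ⊂ L ∪ R := Finset.subset_union_left.ssubset_of_ne fun h =>
        hRn.ne_empty (Finset.disjoint_self_iff_empty R |>.1
          (hLR.mono_left (h ▸ Finset.subset_union_right)))
      have hRI : R ⊂ L ∪ R := Finset.subset_union_right.ssubset_of_ne fun h =>
        hLn.ne_empty (Finset.disjoint_self_iff_empty L |>.1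
          (hLR.mono_right (h ▸ Finset.subset_union_left)))
      rw [τ.localStratum_union r hL hR hLR hI]
      exact isPathConnected_inter_apart hrank (τ.isLocalOn_localStratum r L)
        (τ.isLocalOn_localStratum r R) hLR hLn hRn (ih L hLI hL) (ih R hRI hR)
    · have huniv : τ.localStratum E r I = Set.univ := by
        refine Set.eq_univ_of_forall fun x => ⟨fun i hi j hj hij => ?_,
          fun L hL R hR hLR _ hsub => ?_⟩
        · exact absurd (Finset.one_lt_card.2 ⟨i, hi, j, hj, hij⟩) hcard
        · obtain ⟨a, ha⟩ := τ.nonempty_of_mem L hL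
          obtain ⟨b, hb⟩ := τ.nonempty_of_mem R hR
          refine absurd (Finset.one_lt_card.2 ⟨a, hsub (Finset.mem_union_left _ ha), b,
            hsub (Finset.mem_union_right _ hb), ?_⟩) hcard
          rintro rfl
          exact Finset.disjoint_left.1 hLR ha hb
      rw [huniv]
      exact isPathConnected_univ

lemma stratum_eq_localStratum (d : ℕ) (r : J → ℝ) :
    stratum d r τ = τ.localStratum (EuclideanSpace ℝ (Fin d)) r Finset.univ := by
  have key : ∀ (x : J → EuclideanSpace ℝ (Fin d)) (L : Finset J),
      (sepVec τ x L ≠ 0 ∧ ∀ i ∈ L, 0 ≤ separation τ x L i) ↔ OnSide x L (τ.sibling L) := by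
    intro x L
    refine and_congr_right fun h => forall₂_congr fun i hi => ?_
    rw [separation, inner_smul_right]
    exact mul_nonneg_iff_of_pos_left (inv_pos.2 (norm_pos_iff.2 h))
  ext x
  constructor
  · rintro ⟨h₁, h₂⟩
    refine ⟨fun i _ j _ => h₁ i j, fun L hL R hR hLR hU _ => ?_⟩
    obtain ⟨b, hb⟩ := τ.nonempty_of_mem R hR
    have hne : L ≠ Finset.univ := by
      rintro rfl
      exact Finset.disjoint_right.1 hLR hb (Finset.mem_univ b)
    have := (key x L).1 (h₂ L hL hne)
    rwa [τ.sibling_eq hL hR hLR hU] at this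
  · rintro ⟨h₁, h₂⟩
    refine ⟨fun i j => h₁ i (Finset.mem_univ i) j (Finset.mem_univ j), fun L hL hne => ?_⟩
    obtain ⟨R, hR, hLR, hU⟩ := τ.exists_sibling hL hne
    rw [key, τ.sibling_eq hL hR hLR hU]
    exact h₂ L hL R hR hLR hU (Finset.subset_univ _)

end BinaryHierarchy

/-- for ambient dimension `d ≥ 2` the stratum is path-connected. -/
theorem stratum_pathConnected (d : ℕ) (hd : 2 ≤ d) (r : J → ℝ) (hr : ∀ j, 0 ≤ r j)
    (τ : BinaryHierarchy J) : IsPathConnected (stratum d r τ) := by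
  rw [τ.stratum_eq_localStratum]
  refine τ.isPathConnected_localStratum ?_ r Finset.univ τ.root_mem
  rw [← Module.finrank_eq_rank, finrank_euclideanSpace_fin]
  exact_mod_cast hd
end
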